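/- Let Λ be a ring with 1 whose underlying additive group is a free ℤ-module of finite positive rank and such that Λ⊗ℚ is a semisimple ℚ-algebra, and let M be a free abelian group of finite positive rank equipped with a right Λ-module structure. Then M is a locally free right Λ-module of rank 1 (i.e., for every prime ℓ the right Λ⊗ℤ_ℓ-module M⊗ℤ_ℓ is free of rank 1) if and only if for every prime ℓ the right Λ⊗ℤ_(ℓ)-module M⊗ℤ_(ℓ) is free of rank 1. -/

import Mathlib

/-!
STATEMENT 0. A right module over a ring `Λ` is formalized as a module over the opposite
ring `Λᵐᵒᵖ`; accordingly, a right module over the base change `Λ ⊗ ℤ_ℓ` is formalized as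
a module over `Λᵐᵒᵖ ⊗[ℤ] ℤ_[ℓ]`.  The module structure of `Λᵐᵒᵖ ⊗[ℤ] S` on `M ⊗[ℤ] S`
(for a commutative ring `S`) is the canonical one: `Λᵐᵒᵖ` acts on the first factor and
`S` by multiplication on the second factor; it is constructed below.
"Free of rank 1" is expressed as the existence of a basis indexed by `Fin 1`.
-/

open scoped TensorProduct

namespace AlmostIso

variable (A S M : Type*) [Ring A] [CommRing S] [AddCommGroup M] [Module A M]

/-- Multiplication by elements of `S` on the second factor of `M ⊗[ℤ] S`,
as a ring homomorphism into `ℤ`-linear endomorphisms. -/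
noncomputable def rmulHom : S →+* Module.End ℤ (M ⊗[ℤ] S) where
  toFun s := LinearMap.lTensor M (LinearMap.mulLeft ℤ s)
  map_one' := by
    rw [LinearMap.mulLeft_one, LinearMap.lTensor_id]; rfl
  map_mul' s t := by
    rw [LinearMap.mulLeft_mul, LinearMap.lTensor_comp]; rfl
  map_zero' := by
    rw [LinearMap.mulLeft_zero_eq_zero, LinearMap.lTensor_zero]; rfl
  map_add' s t := by
    have h : LinearMap.mulLeft ℤ (s + t) = LinearMap.mulLeft ℤ s + LinearMap.mulLeft ℤ t := by
      ext x; simp [add_mul]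
    rw [h, LinearMap.lTensor_add]; rfl

theorem commute_lsmul_rmul (a : A) (s : S) :
    Commute ((Algebra.lsmul ℤ ℤ (M ⊗[ℤ] S) : A →ₐ[ℤ] Module.End ℤ (M ⊗[ℤ] S)) a)
      ((rmulHom S M).toIntAlgHom s) := by
  refine LinearMap.ext fun x => ?_
  induction x using TensorProduct.induction_on with
  | zero => simp [Module.End.mul_apply]
  | tmul m t =>
      simp [Module.End.mul_apply, rmulHom, RingHom.toIntAlgHom_apply,
        TensorProduct.smul_tmul']
      rfl
  | add x y hx hy =>
      simp only [Module.End.mul_apply, map_add] at hx hy ⊢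
      rw [hx, hy]

/-- The base change `M ⊗[ℤ] S` of a module `M` over `A` is a module over
`A ⊗[ℤ] S`: `A` acts on the first factor and `S` by multiplication on the second. -/
noncomputable instance bcModule : Module (A ⊗[ℤ] S) (M ⊗[ℤ] S) :=
  Module.compHom _
    (Algebra.TensorProduct.lift (Algebra.lsmul ℤ ℤ (M ⊗[ℤ] S))
      (rmulHom S M).toIntAlgHom (commute_lsmul_rmul A S M)).toRingHom

end AlmostIso


/-- The localization `ℤ_(ℓ)` of `ℤ` at the prime `ℓ`, realized as the subring of `ℚ`
of rationals that are `ℓ`-adically integral (equivalently, whose denominator is prime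
to `ℓ`); one has `ℤ_(ℓ) = ℤ_ℓ ∩ ℚ` inside `ℚ_ℓ`. -/
def ZLoc (ℓ : ℕ) [Fact ℓ.Prime] : Subring ℚ where
  carrier := {q : ℚ | padicNorm ℓ q ≤ 1}
  zero_mem' := by simp [padicNorm.zero]
  one_mem' := by simp [padicNorm.one]
  add_mem' {a b} ha hb := le_trans (padicNorm.nonarchimedean) (max_le ha hb)
  mul_mem' {a b} ha hb := by
    rw [Set.mem_setOf_eq, padicNorm.mul]
    exact mul_le_one₀ ha (padicNorm.nonneg _) hb
  neg_mem' {a} ha := by rw [Set.mem_setOf_eq, padicNorm.neg]; exact ha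

namespace AlmostIso

section BaseChange

variable {A S M : Type*} [Ring A] [CommRing S] [AddCommGroup M] [Module A M]

theorem tmul_smul_tmul (a : A) (s : S) (m : M) (t : S) :
    (a ⊗ₜ[ℤ] s : A ⊗[ℤ] S) • (m ⊗ₜ[ℤ] t : M ⊗[ℤ] S) = (a • m) ⊗ₜ[ℤ] (s * t) := by
  change (Algebra.TensorProduct.lift (Algebra.lsmul ℤ ℤ (M ⊗[ℤ] S))
      (rmulHom S M).toIntAlgHom (commute_lsmul_rmul A S M)) (a ⊗ₜ[ℤ] s) (m ⊗ₜ[ℤ] t) = _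
  rw [Algebra.TensorProduct.lift_tmul, Module.End.mul_apply]
  change a • LinearMap.lTensor M (LinearMap.mulLeft ℤ s) (m ⊗ₜ[ℤ] t) = _
  rw [LinearMap.lTensor_tmul, LinearMap.mulLeft_apply, TensorProduct.smul_tmul']

theorem comm_one_tmul_smul (s : S) (y : M ⊗[ℤ] S) :
    TensorProduct.comm ℤ M S (((1 : A) ⊗ₜ[ℤ] s : A ⊗[ℤ] S) • y) =
      s • TensorProduct.comm ℤ M S y := by
  induction y using TensorProduct.induction_on with
  | zero => simp
  | tmul m t => simp [tmul_smul_tmul, TensorProduct.smul_tmul']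
  | add x y hx hy => simp only [smul_add, map_add, hx, hy]

theorem comm_symm_smul (s : S) (y : S ⊗[ℤ] A) :
    (TensorProduct.comm ℤ A S).symm (s • y) =
      ((1 : A) ⊗ₜ[ℤ] s : A ⊗[ℤ] S) * (TensorProduct.comm ℤ A S).symm y := by
  induction y using TensorProduct.induction_on with
  | zero => simp
  | tmul t a => simp [TensorProduct.smul_tmul']
  | add x y hx hy => simp only [smul_add, map_add, mul_add, hx, hy]

/-- The `S`-linear map `u ↦ u • x` from `A ⊗ S` to `M ⊗ S`, with the tensor factors swapped
so that the standard `S`-module structures apply. -/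
noncomputable def orbitMap (x : M ⊗[ℤ] S) : (S ⊗[ℤ] A) →ₗ[S] (S ⊗[ℤ] M) where
  toFun u := TensorProduct.comm ℤ M S ((TensorProduct.comm ℤ A S).symm u • x)
  map_add' u v := by simp only [map_add, add_smul]
  map_smul' s u := by
    rw [comm_symm_smul, mul_smul, comm_one_tmul_smul, RingHom.id_apply]

theorem orbitMap_apply (x : M ⊗[ℤ] S) (u : S ⊗[ℤ] A) :
    orbitMap x u = TensorProduct.comm ℤ M S ((TensorProduct.comm ℤ A S).symm u • x) := rfl

theorem bijective_orbitMap_iff (x : M ⊗[ℤ] S) :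
    Function.Bijective (orbitMap (A := A) x) ↔
      Function.Bijective (fun u : A ⊗[ℤ] S => u • x) := by
  have h : (orbitMap (A := A) x : S ⊗[ℤ] A → S ⊗[ℤ] M) =
      TensorProduct.comm ℤ M S ∘ (fun u : A ⊗[ℤ] S => u • x) ∘
        (TensorProduct.comm ℤ A S).symm := rfl
  rw [h, Function.Bijective.of_comp_iff' (TensorProduct.comm ℤ M S).bijective,
    Function.Bijective.of_comp_iff _ (TensorProduct.comm ℤ A S).symm.bijective]

end BaseChange

/-- A module has a basis with one element iff it has an element whose orbit map is bijective. -/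
theorem nonempty_basis_fin_one_iff {R N : Type*} [Ring R] [AddCommGroup N] [Module R N] :
    Nonempty (Module.Basis (Fin 1) R N) ↔
      ∃ x : N, Function.Bijective (fun r : R => r • x) := by
  constructor
  · rintro ⟨b⟩
    let e : R ≃ₗ[R] N := (LinearEquiv.funUnique (Fin 1) R R).symm.trans b.equivFun.symm
    refine ⟨e 1, ?_⟩
    have h : (fun r : R => r • e 1) = e := by
      funext r
      rw [← map_smul, smul_eq_mul, mul_one]
    rw [h]
    exact e.bijective
  · rintro ⟨x, hx⟩
    exact ⟨(Module.Basis.singleton (Fin 1) R).map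
      (LinearEquiv.ofBijective (LinearMap.toSpanSingleton R N x) hx)⟩

section Criterion

variable {A S M : Type*} [Ring A] [CommRing S] [AddCommGroup M] [Module A M] {p : ℕ}

/-- If the integers surject onto `S / p`, they are dense modulo `p` in `M ⊗ S`. -/
theorem exists_eq_tmul_one_add_nsmul
    (hS : ∀ s : S, ∃ (k : ℤ) (t : S), s = k + p * t) (x : M ⊗[ℤ] S) :
    ∃ (m : M) (y : M ⊗[ℤ] S), x = m ⊗ₜ[ℤ] (1 : S) + p • y := by
  induction x using TensorProduct.induction_on with
  | zero => exact ⟨0, 0, by simp⟩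
  | tmul m s =>
    obtain ⟨k, t, rfl⟩ := hS s
    refine ⟨k • m, m ⊗ₜ t, ?_⟩
    rw [TensorProduct.tmul_add, TensorProduct.smul_tmul, ← TensorProduct.tmul_smul]
    simp
  | add x y hx hy =>
    obtain ⟨m, u, rfl⟩ := hx
    obtain ⟨n, v, rfl⟩ := hy
    exact ⟨m + n, u + v, by rw [TensorProduct.add_tmul, smul_add]; abel⟩

theorem exists_eq_nsmul_of_tmul_one_eq_nsmul [Module.Free ℤ M] [Module.Finite ℤ M]
    (hp : p.Prime) (hu : ¬ IsUnit (p : S)) {n : M} {y : M ⊗[ℤ] S}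
    (h : n ⊗ₜ[ℤ] (1 : S) = p • y) : ∃ n' : M, n = p • n' := by
  let b := Module.Free.chooseBasis ℤ M
  have hdvd : ∀ i, (p : ℤ) ∣ b.repr n i := by
    intro i
    have h' := congrArg (TensorProduct.lid ℤ S ∘ LinearMap.rTensor S (b.coord i)) h
    simp only [Function.comp_apply, LinearMap.rTensor_tmul, TensorProduct.lid_tmul,
      map_nsmul, Module.Basis.coord_apply] at h'
    rw [zsmul_one, nsmul_eq_mul] at h'
    by_contra hd
    apply hu
    obtain ⟨u, v, huv⟩ := ((Nat.prime_iff_prime_int.mp hp).coprime_iff_not_dvd).mpr hd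
    have huv' : (u : S) * p + v * (b.repr n i : ℤ) = 1 := by
      exact_mod_cast congrArg (Int.cast : ℤ → S) huv
    rw [h'] at huv'
    refine IsUnit.of_mul_eq_one ((u : S) +
      v * TensorProduct.lid ℤ S (LinearMap.rTensor S (b.coord i) y)) ?_
    rw [← huv']
    ring
  choose c hc using hdvd
  refine ⟨∑ i, c i • b i, ?_⟩
  rw [← natCast_zsmul, Finset.smul_sum]
  refine (b.sum_repr n).symm.trans (Finset.sum_congr rfl fun i _ => ?_)
  rw [hc i, mul_smul]

/-- Let `p` be a prime and `S` a nonzero commutative ring such that `p` lies in the Jacobson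
radical of `S` and `ℤ → S / p` is surjective.  Whether `M ⊗ S` is free of rank one over `A ⊗ S`
then depends only on `p`, and not on `S`. -/
theorem nonempty_basis_baseChange_iff [Nontrivial S] [Module.Free ℤ A] [Module.Finite ℤ A]
    [Module.Free ℤ M] [Module.Finite ℤ M] (hp : p.Prime)
    (hj : (p : S) ∈ (⊥ : Ideal S).jacobson)
    (hS : ∀ s : S, ∃ (k : ℤ) (t : S), s = k + p * t) :
    Nonempty (Module.Basis (Fin 1) (A ⊗[ℤ] S) (M ⊗[ℤ] S)) ↔
      Module.finrank ℤ A = Module.finrank ℤ M ∧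
        ∃ m : M, ∀ n : M, ∃ (a : A) (n' : M), n = a • m + p • n' := by
  have hu : ¬ IsUnit (p : S) := fun h => by
    have htop := Ideal.eq_top_of_isUnit_mem _ hj h
    rw [Ideal.jacobson_eq_top_iff] at htop
    exact bot_ne_top htop
  rw [nonempty_basis_fin_one_iff]
  constructor
  · rintro ⟨x, hx⟩
    refine ⟨?_, ?_⟩
    · have h := LinearEquiv.finrank_eq
        (LinearEquiv.ofBijective (orbitMap (A := A) x) ((bijective_orbitMap_iff x).mpr hx))
      rwa [Module.finrank_baseChange, Module.finrank_baseChange] at h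
    · obtain ⟨m, y, rfl⟩ := exists_eq_tmul_one_add_nsmul hS x
      refine ⟨m, fun n => ?_⟩
      obtain ⟨u, hun⟩ := hx.2 (n ⊗ₜ[ℤ] (1 : S))
      obtain ⟨a, v, rfl⟩ := exists_eq_tmul_one_add_nsmul hS u
      have key : (n - a • m) ⊗ₜ[ℤ] (1 : S) =
          p • ((a ⊗ₜ[ℤ] (1 : S) : A ⊗[ℤ] S) • y + v • (m ⊗ₜ[ℤ] (1 : S) + p • y)) := by
        rw [TensorProduct.sub_tmul, ← hun]
        dsimp only
        rw [add_smul, smul_add (a ⊗ₜ[ℤ] (1 : S) : A ⊗[ℤ] S), tmul_smul_tmul, mul_one,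
          smul_assoc, smul_comm _ p y, smul_add p]
        abel
      obtain ⟨n', hn'⟩ := exists_eq_nsmul_of_tmul_one_eq_nsmul hp hu key
      exact ⟨a, n', by rw [← hn']; abel⟩
  · rintro ⟨hrank, m, hm⟩
    refine ⟨m ⊗ₜ[ℤ] (1 : S), ?_⟩
    rw [← bijective_orbitMap_iff]
    set f := orbitMap (A := A) (m ⊗ₜ[ℤ] (1 : S)) with hf
    have hftmul : ∀ (s : S) (a : A), f (s ⊗ₜ[ℤ] a) = s ⊗ₜ[ℤ] (a • m) := fun s a => by
      rw [hf, orbitMap_apply, TensorProduct.comm_symm_tmul, tmul_smul_tmul,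
        TensorProduct.comm_tmul, mul_one]
    have hsurj : Function.Surjective f := by
      rw [← LinearMap.range_eq_top, eq_top_iff]
      refine Submodule.le_of_le_smul_of_le_jacobson_bot (I := Ideal.span {(p : S)})
        Module.Finite.fg_top ((Ideal.span_singleton_le_iff_mem _).mpr hj) ?_
      intro z _
      induction z using TensorProduct.induction_on with
      | zero => exact zero_mem _
      | tmul s n =>
        obtain ⟨a, n', rfl⟩ := hm n
        rw [TensorProduct.tmul_add]
        refine Submodule.add_mem_sup ⟨s ⊗ₜ a, hftmul s a⟩ ?_
        rw [TensorProduct.tmul_smul, ← Nat.cast_smul_eq_nsmul S]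
        exact Submodule.smul_mem_smul (Ideal.mem_span_singleton_self _) trivial
      | add x y hx hy => exact add_mem (hx trivial) (hy trivial)
    have e : (S ⊗[ℤ] M) ≃ₗ[S] (S ⊗[ℤ] A) := LinearEquiv.ofFinrankEq _ _ (by
      rw [Module.finrank_baseChange, Module.finrank_baseChange, hrank])
    have hinj := OrzechProperty.injective_of_surjective_endomorphism (e.toLinearMap ∘ₗ f)
      (e.surjective.comp hsurj)
    exact ⟨Function.Injective.of_comp hinj, hsurj⟩

end Criterion

end AlmostIso

section Rings

variable (p : ℕ) [hp : Fact p.Prime]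

theorem PadicInt.natCast_mem_jacobson_bot : (p : ℤ_[p]) ∈ (⊥ : Ideal ℤ_[p]).jacobson := by
  rw [IsLocalRing.jacobson_eq_maximalIdeal _ bot_ne_top, PadicInt.maximalIdeal_eq_span_p]
  exact Ideal.mem_span_singleton_self _

theorem PadicInt.exists_eq_intCast_add_mul (s : ℤ_[p]) :
    ∃ (k : ℤ) (t : ℤ_[p]), s = k + p * t := by
  obtain ⟨n, -, hn⟩ := PadicInt.exists_mem_range (x := s)
  rw [PadicInt.maximalIdeal_eq_span_p, Ideal.mem_span_singleton] at hn
  obtain ⟨t, ht⟩ := hn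
  exact ⟨n, t, by rw [← ht]; push_cast; ring⟩

theorem ZLoc.mem_iff (q : ℚ) : q ∈ ZLoc p ↔ padicNorm p q ≤ 1 := Iff.rfl

theorem ZLoc.natCast_mem_jacobson_bot : (p : ZLoc p) ∈ (⊥ : Ideal (ZLoc p)).jacobson := by
  rw [Ideal.mem_jacobson_bot]
  intro y
  have hlt : padicNorm p (p * (y : ℚ)) < 1 := by
    rw [padicNorm.mul]
    exact mul_lt_one_of_nonneg_of_lt_one_left (padicNorm.nonneg _)
      (padicNorm.padicNorm_p_lt_one_of_prime) y.2
  have hnorm : padicNorm p (p * (y : ℚ) + 1) = 1 := by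
    rw [padicNorm.add_eq_max_of_ne (by rw [padicNorm.one]; exact hlt.ne), padicNorm.one]
    exact max_eq_right hlt.le
  have hne : (p * (y : ℚ) + 1) ≠ 0 := fun h => by simp [h] at hnorm
  have hinv : (p * (y : ℚ) + 1)⁻¹ ∈ ZLoc p := by
    rw [ZLoc.mem_iff, ← one_div, padicNorm.div, hnorm, padicNorm.one, div_one]
  refine IsUnit.of_mul_eq_one ⟨_, hinv⟩ (Subtype.ext ?_)
  push_cast
  exact mul_inv_cancel₀ hne

theorem ZLoc.exists_eq_intCast_add_mul (s : ZLoc p) :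
    ∃ (k : ℤ) (t : ZLoc p), s = k + p * t := by
  obtain ⟨q, hq⟩ := s
  have hd : ¬ p ∣ q.den := by
    intro h
    have hn : ¬ (p : ℤ) ∣ q.num := fun h' => by
      have := Nat.dvd_gcd (Int.natCast_dvd.mp h') h
      rw [q.reduced.gcd_eq_one] at this
      exact hp.out.one_lt.ne' (Nat.dvd_one.mp this)
    have h1 : padicNorm p (q * q.den) < 1 := by
      rw [padicNorm.mul]
      exact mul_lt_one_of_nonneg_of_lt_one_right hq (padicNorm.nonneg _)
        (padicNorm.nat_lt_one_iff _ |>.mpr h)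
    rw [Rat.mul_den_eq_num, padicNorm.int_lt_one_iff] at h1
    exact hn h1
  obtain ⟨u, v, huv⟩ := Nat.isCoprime_iff_coprime.mpr ((Nat.Prime.coprime_iff_not_dvd hp.out).mpr hd)
  refine ⟨q.num * v, u * ⟨q, hq⟩, Subtype.ext ?_⟩
  have h := congrArg (Int.cast : ℤ → ℚ) huv
  push_cast at h ⊢
  rw [← Rat.mul_den_eq_num q]
  linear_combination (-q) * h

end Rings

open AlmostIso in
/-- Let `Λ` be a ring whose underlying additive group is a free `ℤ`-module of finite
positive rank, such that `Λ ⊗ ℚ` is a semisimple `ℚ`-algebra, and let `M` be a free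
abelian group of finite positive rank with a right `Λ`-module structure.  Then `M` is a
locally free right `Λ`-module of rank `1` (i.e. for every prime `ℓ` the right
`Λ ⊗ ℤ_ℓ`-module `M ⊗ ℤ_ℓ` is free of rank `1`) if and only if for every prime `ℓ` the
right `Λ ⊗ ℤ_(ℓ)`-module `M ⊗ ℤ_(ℓ)` is free of rank `1`, where `ℤ_(ℓ)` is the
localization of `ℤ` at `ℓ`. -/
theorem locally_free_rank_one_iff_localized_free_rank_one
    (Λ M : Type) [Ring Λ]
    [Module.Free ℤ Λ] [Module.Finite ℤ Λ] (hΛrank : 0 < Module.finrank ℤ Λ)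
    [IsSemisimpleRing (Λ ⊗[ℤ] ℚ)]
    [AddCommGroup M] [Module Λᵐᵒᵖ M]
    [Module.Free ℤ M] [Module.Finite ℤ M] (hMrank : 0 < Module.finrank ℤ M) :
    (∀ (ℓ : ℕ) [Fact ℓ.Prime],
        Nonempty (Module.Basis (Fin 1) (Λᵐᵒᵖ ⊗[ℤ] ℤ_[ℓ]) (M ⊗[ℤ] ℤ_[ℓ]))) ↔
      (∀ (ℓ : ℕ) [Fact ℓ.Prime],
        Nonempty (Module.Basis (Fin 1) (Λᵐᵒᵖ ⊗[ℤ] (ZLoc ℓ)) (M ⊗[ℤ] (ZLoc ℓ)))) := by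
  refine forall_congr' fun ℓ => forall_congr' fun hℓ => ?_
  have : Module.Free ℤ Λᵐᵒᵖ := Module.Free.of_equiv (MulOpposite.opLinearEquiv ℤ)
  have : Module.Finite ℤ Λᵐᵒᵖ := Module.Finite.equiv (MulOpposite.opLinearEquiv ℤ)
  rw [nonempty_basis_baseChange_iff hℓ.out (PadicInt.natCast_mem_jacobson_bot ℓ)
      (PadicInt.exists_eq_intCast_add_mul ℓ),
    nonempty_basis_baseChange_iff hℓ.out (ZLoc.natCast_mem_jacobson_bot ℓ)
      (ZLoc.exists_eq_intCast_add_mul ℓ)]
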